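/- arXiv:math/0611006 — 4 statements merged into one kernel-verified Lean document; each statement's English description precedes it below -/
import Mathlib

section
/- Let H be a discrete ω-dimensional poc-set. Then the set Π of principal ultrafilters on H is dense in H° with respect to the Tychonoff topology. Moreover Π is the only almost-equality class with this property: if Σ is an almost-equality class of H° that is dense in H°, then every element of Σ is principal (in fact, if Σ is a non-principal class then there is a proper h ∈ H with Σ ∩ S_{h*} = ∅, so Σ misses the nonempty open set S_{h*}). -/
universe u

/-- A poc-set: a partially ordered set with minimum `zero` and an order-reversing
involution `star` such that `h ≤ star h` implies `h = zero`. -/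
structure PocSet (H : Type u) [PartialOrder H] : Type u where
  star : H → H
  zero : H
  zero_le : ∀ h : H, zero ≤ h
  star_star : ∀ h : H, star (star h) = h
  star_antitone : ∀ a b : H, a ≤ b → star b ≤ star a
  eq_zero_of_le_star : ∀ h : H, h ≤ star h → h = zero

namespace PocSet

variable {H : Type u} [PartialOrder H]

/-- An element is proper if it is neither `0` nor `0*`. -/
def Proper (P : PocSet H) (h : H) : Prop := h ≠ P.zero ∧ h ≠ P.star P.zero

/-- A poc-set is discrete if every interval between proper elements is finite. -/
def IsDiscrete (P : PocSet H) : Prop :=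
  ∀ a b : H, P.Proper a → P.Proper b → (Set.Icc a b).Finite

/-- Two elements are transverse if none of the four nesting relations holds. -/
def Transverse (P : PocSet H) (a b : H) : Prop :=
  ¬ a ≤ b ∧ ¬ P.star a ≤ b ∧ ¬ a ≤ P.star b ∧ ¬ P.star a ≤ P.star b

/-- ω-dimensionality: no infinite subset of pairwise transverse elements. -/
def OmegaDimensional (P : PocSet H) : Prop :=
  ∀ S : Set H, S.Pairwise P.Transverse → S.Finite

/-- Ultrafilter on a poc-set: (UF1) exactly one of `h`, `h*` belongs;
(UF2) no `h ≤ k*` for members `h, k`. -/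
def IsUltra (P : PocSet H) (α : Set H) : Prop :=
  (∀ h : H, h ∈ α ↔ P.star h ∉ α) ∧ ∀ h ∈ α, ∀ k ∈ α, ¬ h ≤ P.star k

/-- An infinite strictly descending chain of elements of `ξ`. -/
def DescChainIn (ξ : Set H) (c : ℕ → H) : Prop :=
  (∀ n, c n ∈ ξ) ∧ ∀ n, c (n + 1) < c n

/-- Principal ultrafilter: an ultrafilter with no infinite strictly descending chain. -/
def IsPrincipal (P : PocSet H) (α : Set H) : Prop :=
  P.IsUltra α ∧ ¬ ∃ c : ℕ → H, DescChainIn α c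

/-- The set of minimal elements of `α`. -/
def minset (α : Set H) : Set H := {a ∈ α | ∀ b ∈ α, b ≤ a → b = a}

/-- Almost equality: both differences are finite. -/
def AlmostEq (α β : Set H) : Prop := (α \ β).Finite ∧ (β \ α).Finite

/-- `Sg` is an almost-equality class of ultrafilters on `P`. -/
def IsAEClass (P : PocSet H) (Sg : Set (Set H)) : Prop :=
  ∃ α : Set H, P.IsUltra α ∧ Sg = {β | P.IsUltra β ∧ AlmostEq α β}

-- The Tychonoff topology on subsets of `H`, induced from the product topology
-- on `H → Bool` (with `Bool` discrete) via characteristic functions.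
open Classical in
noncomputable def tychonoff (H : Type u) : TopologicalSpace (Set H) :=
  TopologicalSpace.induced (fun (α : Set H) (h : H) => decide (h ∈ α)) inferInstance

/-- The median of three subsets of `H`. -/
def med (α β γ : Set H) : Set H := (α ∩ β) ∪ (β ∩ γ) ∪ (α ∩ γ)

end PocSet

open PocSet

open PocSet

namespace PocSet

theorem mem_closure_tychonoff {H : Type u} {α : Set H} {S : Set (Set H)} :
    α ∈ @closure _ (tychonoff H) S ↔ ∀ I : Finset H, ∃ β ∈ S, ∀ h ∈ I, (h ∈ β ↔ h ∈ α) := by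
  classical
  let _ : TopologicalSpace (Set H) := tychonoff H
  rw [mem_closure_iff]
  constructor
  · intro hcl I
    obtain ⟨β, hβ, hβS⟩ := hcl
      ((fun (α : Set H) (h : H) => decide (h ∈ α)) ⁻¹'
        (I : Set H).pi fun h => {decide (h ∈ α)})
      ⟨(I : Set H).pi fun h => {decide (h ∈ α)},
        isOpen_set_pi I.finite_toSet fun _ _ => isOpen_discrete _, rfl⟩
      (fun h _ => by simp)
    exact ⟨β, hβS, fun h hh => by simpa using hβ h hh⟩
  · rintro hI _ ⟨U, hU, rfl⟩ hα
    obtain ⟨I, u, hu, huU⟩ := isOpen_pi_iff.1 hU _ hα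
    obtain ⟨β, hβS, hβ⟩ := hI I
    refine ⟨β, huU fun h hh => ?_, hβS⟩
    have hmem := (hu h hh).2
    simp only [← hβ h hh] at hmem
    convert hmem

variable {H : Type u} [PartialOrder H] {P : PocSet H} {α β F T : Set H} {a b : H}

theorem star_le_comm (P : PocSet H) : P.star a ≤ b ↔ P.star b ≤ a :=
  ⟨fun h => by simpa [P.star_star] using P.star_antitone _ _ h,
    fun h => by simpa [P.star_star] using P.star_antitone _ _ h⟩

theorem le_star_comm (P : PocSet H) : a ≤ P.star b ↔ b ≤ P.star a :=
  ⟨fun h => by simpa [P.star_star] using P.star_antitone _ _ h,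
    fun h => by simpa [P.star_star] using P.star_antitone _ _ h⟩

theorem Proper.star (h : P.Proper a) : P.Proper (P.star a) := by
  refine ⟨fun h0 => h.2 ?_, fun h0 => h.1 ?_⟩
  · rw [← h0, P.star_star]
  · rw [← P.star_star a, h0, P.star_star]

theorem Proper.not_le_star (h : P.Proper a) : ¬ a ≤ P.star a :=
  fun h' => h.1 (P.eq_zero_of_le_star a h')

theorem le_star_zero (P : PocSet H) (a : H) : a ≤ P.star P.zero :=
  P.le_star_comm.1 (P.zero_le _)

theorem Transverse.symm (h : P.Transverse a b) : P.Transverse b a := by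
  obtain ⟨h1, h2, h3, h4⟩ := h
  refine ⟨fun h => h4 (P.star_antitone _ _ h), fun h => h2 (P.star_le_comm.1 h),
    fun h => h3 (P.le_star_comm.1 h), fun h => h1 ?_⟩
  simpa [P.star_star] using P.star_antitone _ _ h

/-- A strictly descending chain of proper elements has only finitely many terms above a proper
element. -/
theorem IsDiscrete.finite_setOf_le_chain (hd : P.IsDiscrete) {c : ℕ → H} (hc : StrictAnti c)
    (hp : ∀ n, P.Proper (c n)) (ha : P.Proper a) : {n | a ≤ c n}.Finite :=
  Set.Finite.of_finite_image ((hd a (c 0) ha (hp 0)).subset (by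
    rintro _ ⟨n, hn, rfl⟩
    exact ⟨hn, hc.antitone (Nat.zero_le n)⟩)) hc.injective.injOn

namespace IsUltra

theorem zero_notMem (hα : P.IsUltra α) : P.zero ∉ α :=
  fun h => hα.2 _ h _ h (P.zero_le _)

theorem star_zero_mem (hα : P.IsUltra α) : P.star P.zero ∈ α :=
  by_contra fun h => hα.zero_notMem ((hα.1 _).2 h)

theorem star_mem (hα : P.IsUltra α) (h : a ∉ α) : P.star a ∈ α :=
  by_contra fun h' => h ((hα.1 _).2 h')

theorem mem_of_le (hα : P.IsUltra α) (ha : a ∈ α) (hab : a ≤ b) : b ∈ α :=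
  by_contra fun hb => hα.2 a ha _ (hα.star_mem hb) (by rwa [P.star_star])

theorem proper_of_mem (hα : P.IsUltra α) (ha : a ∈ α) (h : a ≠ P.star P.zero) : P.Proper a :=
  ⟨fun h0 => hα.zero_notMem (h0 ▸ ha), h⟩

end IsUltra

/-- Dropping the first term of a descending chain in an ultrafilter makes all terms proper. -/
theorem IsUltra.proper_chain (hα : P.IsUltra α) {c : ℕ → H} (hc : DescChainIn α c) (n : ℕ) :
    P.Proper (c (n + 1)) :=
  hα.proper_of_mem (hc.1 _) fun h => absurd (P.le_star_zero (c n)) (h ▸ (hc.2 n).not_ge)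

theorem DescChainIn.strictAnti {c : ℕ → H} (hc : DescChainIn α c) : StrictAnti c :=
  strictAnti_nat_of_succ_lt hc.2

theorem IsUltra.isPrincipal_of (hα : P.IsUltra α)
    (h : ∀ c : ℕ → H, DescChainIn α c → (∀ n, P.Proper (c n)) → False) : P.IsPrincipal α :=
  ⟨hα, fun ⟨c, hc⟩ => h (fun n => c (n + 1)) ⟨fun _ => hc.1 _, fun _ => hc.2 _⟩
    (hα.proper_chain hc)⟩

/-- The ultrafilter `α` modified so as to contain every element of `F`. -/
def gate (P : PocSet H) (α F : Set H) : Set H :=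
  {k | (∃ f ∈ F, f ≤ k) ∨ (k ∈ α ∧ ∀ f ∈ F, ¬ k ≤ P.star f)}

theorem subset_gate (P : PocSet H) (α F : Set H) : F ⊆ P.gate α F :=
  fun f hf => Or.inl ⟨f, hf, le_rfl⟩

theorem IsUltra.gate (hα : P.IsUltra α) (hF : ∀ f ∈ F, ∀ g ∈ F, ¬ f ≤ P.star g) :
    P.IsUltra (P.gate α F) := by
  have key : ∀ k ∈ P.gate α F, ∀ l ∈ P.gate α F, ¬ k ≤ P.star l := by
    rintro k (⟨f, hf, hfk⟩ | ⟨hk, hkF⟩) l (⟨g, hg, hgl⟩ | ⟨hl, hlF⟩) hkl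
    · exact hF f hf g hg (hfk.trans (hkl.trans (P.star_antitone _ _ hgl)))
    · exact hlF f hf (P.le_star_comm.1 (hfk.trans hkl))
    · exact hkF g hg (hkl.trans (P.star_antitone _ _ hgl))
    · exact hα.2 k hk l hl hkl
  refine ⟨fun k => ⟨fun hk hk' => key k hk _ hk' (by rw [P.star_star]), fun hk => ?_⟩, key⟩
  by_contra hk'
  simp only [PocSet.gate, Set.mem_ofPred_eq, not_or, not_exists, not_and] at hk hk'
  by_cases hkα : k ∈ α
  · exact hk'.2 hkα fun f hf hfk => hk.1 f hf (P.le_star_comm.1 hfk)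
  · refine hk.2 (hα.star_mem hkα) fun f hf hfk => hk'.1 f hf ?_
    simpa [P.star_star] using P.star_antitone _ _ hfk

theorem IsPrincipal.gate (hd : P.IsDiscrete) (hα : P.IsPrincipal α) (hfin : F.Finite)
    (hp : ∀ f ∈ F, P.Proper f) (hF : ∀ f ∈ F, ∀ g ∈ F, ¬ f ≤ P.star g) :
    P.IsPrincipal (P.gate α F) := by
  refine (hα.1.gate hF).isPrincipal_of fun c hc hcp => ?_
  have hbad : (⋃ f ∈ F, {n | f ≤ c n}).Finite :=
    hfin.biUnion fun f hf => hd.finite_setOf_le_chain hc.strictAnti hcp (hp f hf)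
  obtain ⟨N, hN⟩ := hbad.bddAbove
  refine hα.2 ⟨fun n => c (n + (N + 1)), fun n => ?_, fun n => hc.strictAnti (by omega)⟩
  rcases hc.1 (n + (N + 1)) with ⟨f, hf, hfc⟩ | h
  · have : n + (N + 1) ≤ N := hN (Set.mem_biUnion hf hfc)
    omega
  · exact h.1

/-- The ultrafilter in which the elements of the transverse set `T` are minimal. -/
def vertex (P : PocSet H) (T : Set H) : Set H := {k | ∃ t ∈ T, t ≤ k ∨ P.star k < t}

theorem isUltra_vertex (hT : Maximal (fun S : Set H => S ⊆ {a | P.Proper a} ∧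
    S.Pairwise P.Transverse) T) (hne : T.Nonempty) : P.IsUltra (P.vertex T) := by
  obtain ⟨hTp, hTt⟩ := hT.prop
  have hlt : ∀ s ∈ T, ∀ t ∈ T, ¬ s < t := fun s hs t ht h =>
    (hTt hs ht h.ne).1 h.le
  have hdisj : ∀ s ∈ T, ∀ t ∈ T, ¬ s ≤ P.star t := fun s hs t ht h => by
    obtain rfl | hst := eq_or_ne s t
    · exact (hTp hs).not_le_star h
    · exact (hTt hs ht hst).2.2.1 h
  have hcodisj : ∀ s ∈ T, ∀ t ∈ T, ¬ P.star s ≤ t := fun s hs t ht h => by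
    obtain rfl | hst := eq_or_ne s t
    · exact (hTp hs).star.not_le_star (by rwa [P.star_star])
    · exact (hTt hs ht hst).2.1 h
  have key : ∀ k ∈ P.vertex T, ∀ l ∈ P.vertex T, ¬ k ≤ P.star l := by
    rintro k ⟨t, ht, htk | htk⟩ l ⟨s, hs, hsl | hsl⟩ hkl
    · exact hdisj t ht s hs (htk.trans (hkl.trans (P.star_antitone _ _ hsl)))
    · exact hlt t ht s hs ((htk.trans hkl).trans_lt hsl)
    · exact hlt s hs t ht ((hsl.trans (P.le_star_comm.1 hkl)).trans_lt htk)
    · exact hcodisj t ht s hs ((P.star_le_comm.1 htk.le).trans (hkl.trans hsl.le))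
  refine ⟨fun k => ⟨fun hk hk' => key k hk _ hk' (by rw [P.star_star]), fun hk => ?_⟩, key⟩
  by_contra hk'
  simp only [vertex, Set.mem_ofPred_eq, not_exists, not_and, not_or, P.star_star] at hk hk'
  have hkT : k ∉ T := fun h => (hk' k h).1 le_rfl
  have htr : ∀ t ∈ T, P.Transverse k t := fun t ht => by
    refine ⟨fun h => ?_, fun h => ?_, fun h => (hk t ht).1 (P.le_star_comm.1 h), fun h =>
      (hk' t ht).1 (by simpa [P.star_star] using P.star_antitone _ _ h)⟩
    · exact (hk t ht).2 (lt_of_le_of_ne h fun h' => hkT (h' ▸ ht))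
    · exact (hk' t ht).2 (lt_of_le_of_ne h fun h' => (hk t ht).1 h'.ge)
  have hkp : P.Proper k := by
    obtain ⟨t, ht⟩ := hne
    exact ⟨fun h => (htr t ht).1 (h ▸ P.zero_le t),
      fun h => (hk' t ht).1 (h ▸ P.le_star_zero t)⟩
  have hins : insert k T ⊆ T := hT.2 ⟨Set.insert_subset hkp hTp,
    hTt.insert fun t ht _ => ⟨htr t ht, (htr t ht).symm⟩⟩ (Set.subset_insert k T)
  exact hkT (hins (Set.mem_insert k T))

theorem isPrincipal_vertex (hd : P.IsDiscrete) (hfin : T.Finite)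
    (hT : Maximal (fun S : Set H => S ⊆ {a | P.Proper a} ∧ S.Pairwise P.Transverse) T)
    (hne : T.Nonempty) : P.IsPrincipal (P.vertex T) := by
  refine (isUltra_vertex hT hne).isPrincipal_of fun c hc hcp => ?_
  have hbelow : ∀ t, P.Proper t → {n | P.star (c n) ≤ t}.Finite := fun t ht =>
    Set.Finite.of_finite_image ((hd _ t (hcp 0).star ht).subset (by
      rintro _ ⟨n, hn, rfl⟩
      exact ⟨P.star_antitone _ _ (hc.strictAnti.antitone (Nat.zero_le n)), hn⟩))
      ((Function.LeftInverse.injective P.star_star).comp hc.strictAnti.injective).injOn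
  refine Set.infinite_univ (α := ℕ) ((hfin.biUnion fun t ht =>
    (hd.finite_setOf_le_chain hc.strictAnti hcp (hT.prop.1 ht)).union
      (hbelow t (hT.prop.1 ht))).subset fun n _ => ?_)
  obtain ⟨t, ht, h⟩ := hc.1 n
  exact Set.mem_biUnion ht (h.imp id le_of_lt)

theorem exists_isPrincipal (hd : P.IsDiscrete) (hω : P.OmegaDimensional)
    (hα : P.IsUltra α) : ∃ β, P.IsPrincipal β := by
  by_cases hex : ∃ a, P.Proper a
  · obtain ⟨a, ha⟩ := hex
    obtain ⟨T, haT, hT⟩ := zorn_subset_nonempty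
      {S : Set H | S ⊆ {a | P.Proper a} ∧ S.Pairwise P.Transverse}
      (fun C hC hchain _ => ⟨⋃₀ C, ⟨Set.sUnion_subset fun S hS => (hC hS).1,
        (Set.pairwise_sUnion hchain.directedOn).2 fun S hS => (hC hS).2⟩,
        fun S hS => Set.subset_sUnion_of_mem hS⟩)
      {a} ⟨Set.singleton_subset_iff.2 ha, Set.pairwise_singleton _ _⟩
    exact ⟨P.vertex T, isPrincipal_vertex hd (hω T hT.prop.2) hT ⟨a, haT rfl⟩⟩
  · exact ⟨α, hα.isPrincipal_of fun c _ hcp => hex ⟨_, hcp 0⟩⟩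

theorem isUltra_mem_closure_isPrincipal (hd : P.IsDiscrete) (hω : P.OmegaDimensional)
    (hα : P.IsUltra α) : α ∈ @closure _ (tychonoff H) {β | P.IsPrincipal β} := by
  refine mem_closure_tychonoff.2 fun I => ?_
  obtain ⟨β, hβ⟩ := exists_isPrincipal hd hω hα
  have hFα : (α ∩ (I ∪ P.star '' I)) \ {P.star P.zero} ⊆ α := fun f hf => hf.1.1
  have hg := hβ.gate hd (F := (α ∩ (I ∪ P.star '' I)) \ {P.star P.zero})
    (((I.finite_toSet.union (I.finite_toSet.image _)).inter_of_right α).sdiff)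
    (fun f hf => hα.proper_of_mem hf.1.1 hf.2) (fun f hf g hg => hα.2 f (hFα hf) g (hFα hg))
  have hsub : ∀ f ∈ α, f ∈ (I : Set H) ∪ P.star '' I → f ∈ P.gate β
      ((α ∩ (I ∪ P.star '' I)) \ {P.star P.zero}) := fun f hf hfI => by
    by_cases h0 : f = P.star P.zero
    · rw [h0]; exact hg.1.star_zero_mem
    · exact P.subset_gate _ _ ⟨⟨hf, hfI⟩, h0⟩
  refine ⟨_, hg, fun h hh => ⟨fun hhg => by_contra fun hhα => ?_, fun hhα =>
    hsub h hhα (Or.inl hh)⟩⟩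
  exact (hg.1.1 h).1 hhg (hsub _ (hα.star_mem hhα) (Or.inr ⟨h, hh, rfl⟩))

/-- The members of a chain witnessing non-principality lie in every almost equal ultrafilter. -/
theorem DescChainIn.mem_of_finite_diff {c : ℕ → H} (hc : DescChainIn α c) (hβ : P.IsUltra β)
    (hfin : (α \ β).Finite) (n : ℕ) : c n ∈ β := by
  by_contra hn
  refine Set.infinite_range_of_injective
    (hc.strictAnti.injective.comp (add_left_injective n)) (hfin.subset ?_)
  rintro _ ⟨m, rfl⟩
  exact ⟨hc.1 _, fun h => hn (hβ.mem_of_le h (hc.strictAnti.antitone (Nat.le_add_left n m)))⟩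

theorem IsAEClass.isUltra {Sg : Set (Set H)} (hS : P.IsAEClass Sg) (hα : α ∈ Sg) :
    P.IsUltra α := by
  obtain ⟨γ, -, rfl⟩ := hS
  exact hα.1

theorem IsAEClass.finite_diff {Sg : Set (Set H)} (hS : P.IsAEClass Sg) (hα : α ∈ Sg)
    (hβ : β ∈ Sg) : (α \ β).Finite := by
  obtain ⟨γ, -, rfl⟩ := hS
  exact (hα.2.2.union hβ.2.1).subset fun x hx =>
    (em (x ∈ γ)).elim (fun h => Or.inr ⟨h, hx.2⟩) fun h => Or.inl ⟨hx.1, h⟩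

theorem IsAEClass.exists_proper_forall_star_notMem {Sg : Set (Set H)} (hS : P.IsAEClass Sg)
    (hα : α ∈ Sg) (hnp : ¬ P.IsPrincipal α) :
    ∃ h : H, P.Proper h ∧ (∀ β ∈ Sg, P.star h ∉ β) ∧ ∃ β : Set H, P.IsUltra β ∧ P.star h ∈ β := by
  have hu := hS.isUltra hα
  obtain ⟨c, hc⟩ : ∃ c : ℕ → H, DescChainIn α c := by_contra fun h => hnp ⟨hu, h⟩
  have hp := hu.proper_chain hc 0
  refine ⟨c 1, hp, fun β hβ => ((hS.isUltra hβ).1 _).1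
    (hc.mem_of_finite_diff (hS.isUltra hβ) (hS.finite_diff hα hβ) 1),
    P.gate α {P.star (c 1)}, hu.gate ?_, P.subset_gate _ _ rfl⟩
  rintro _ rfl _ rfl
  exact hp.star.not_le_star

end PocSet

theorem stmt2 {H : Type u} [PartialOrder H] (P : PocSet H)
    (hdisc : P.IsDiscrete) (homega : P.OmegaDimensional) :
    (letI : TopologicalSpace (Set H) := tychonoff H
     ({α : Set H | P.IsUltra α} ⊆ closure {α : Set H | P.IsPrincipal α}) ∧
     (∀ Sg : Set (Set H), IsAEClass P Sg →
        {α : Set H | P.IsUltra α} ⊆ closure Sg → ∀ α ∈ Sg, P.IsPrincipal α) ∧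
     (∀ Sg : Set (Set H), IsAEClass P Sg → (∃ α ∈ Sg, ¬ P.IsPrincipal α) →
        ∃ h : H, P.Proper h ∧ (∀ α ∈ Sg, P.star h ∉ α) ∧
          ∃ β : Set H, P.IsUltra β ∧ P.star h ∈ β)) := by
  refine ⟨fun α hα => isUltra_mem_closure_isPrincipal hdisc homega hα, fun Sg hS hdense α hα => ?_,
    fun Sg hS ⟨α, hα, hnp⟩ => hS.exists_proper_forall_star_notMem hα hnp⟩
  by_contra hnp
  obtain ⟨h, -, hmiss, β, hβ, hhβ⟩ := hS.exists_proper_forall_star_notMem hα hnp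
  obtain ⟨γ, hγ, hγβ⟩ := mem_closure_tychonoff.1 (hdense hβ) {P.star h}
  exact hmiss γ hγ ((hγβ _ (Finset.mem_singleton_self _)).2 hhβ)
end

section
/- Let H be a poc-set and let Σ be an almost-equality class of H°. Then Σ is closed under the median operation with arbitrary third argument: for all α, β ∈ Σ and all σ ∈ H°, the set med(α,β,σ) = (α∩β) ∪ (β∩σ) ∪ (α∩σ) is an ultrafilter on H that is almost equal to α and β, hence med(α,β,σ) ∈ Σ. In particular every almost-equality class is a convex subset of the median algebra H°. -/
universe u

open PocSet

namespace PocSet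

theorem AlmostEq.symm {H : Type u} {α β : Set H} (h : AlmostEq α β) : AlmostEq β α :=
  ⟨h.2, h.1⟩

theorem AlmostEq.trans {H : Type u} {α β γ : Set H} (h₁ : AlmostEq α β)
    (h₂ : AlmostEq β γ) : AlmostEq α γ := by
  refine ⟨(h₁.1.union h₂.1).subset ?_, (h₁.2.union h₂.2).subset ?_⟩ <;>
    · rintro x ⟨hx, hx'⟩
      by_cases hβ : x ∈ β <;> simp_all

theorem IsUltra.med {H : Type u} [PartialOrder H] {P : PocSet H} {α β γ : Set H}
    (hα : P.IsUltra α) (hβ : P.IsUltra β) (hγ : P.IsUltra γ) :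
    P.IsUltra (PocSet.med α β γ) := by
  constructor
  · intro h
    have h₁ := hα.1 h
    have h₂ := hβ.1 h
    have h₃ := hγ.1 h
    simp only [PocSet.med, Set.mem_union, Set.mem_inter_iff]
    tauto
  · intro h hh k hk hle
    have h₁ : h ∈ α → k ∉ α := fun a b => hα.2 h a k b hle
    have h₂ : h ∈ β → k ∉ β := fun a b => hβ.2 h a k b hle
    have h₃ : h ∈ γ → k ∉ γ := fun a b => hγ.2 h a k b hle
    simp only [PocSet.med, Set.mem_union, Set.mem_inter_iff] at hh hk
    tauto

theorem AlmostEq.med_left {H : Type u} {α β : Set H} (h : AlmostEq α β) (γ : Set H) :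
    AlmostEq (PocSet.med α β γ) α := by
  refine ⟨h.2.subset ?_, h.1.subset ?_⟩ <;>
    · rintro x ⟨hx, hx'⟩
      simp only [PocSet.med, Set.mem_union, Set.mem_inter_iff, Set.mem_sdiff] at hx hx' ⊢
      tauto

end PocSet

open PocSet

theorem stmt3 {H : Type u} [PartialOrder H] (P : PocSet H)
    (Sg : Set (Set H)) (hSg : IsAEClass P Sg)
    (α β : Set H) (hα : α ∈ Sg) (hβ : β ∈ Sg)
    (σ : Set H) (hσ : P.IsUltra σ) :
    P.IsUltra (med α β σ) ∧ AlmostEq (med α β σ) α ∧ AlmostEq (med α β σ) β ∧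
      med α β σ ∈ Sg := by
  obtain ⟨ξ, -, rfl⟩ := hSg
  have hαβ : AlmostEq α β := hα.2.symm.trans hβ.2
  have hmed := hα.1.med hβ.1 hσ
  have hmα := hαβ.med_left σ
  exact ⟨hmed, hmα, hmα.trans hαβ, hmed, hα.2.trans hmα.symm⟩
end

section
/- Let H be a poc-set and let (σ_n)_{n≥1} and (τ_n)_{n≥1} be sequences of ultrafilters on H converging in the Tychonoff topology to σ ∈ H° and τ ∈ H° respectively. If there exists M ∈ ℕ such that the cardinality of σ_n \ τ_n is at most M for all n, then σ \ τ is finite, i.e., σ and τ are almost equal. -/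
universe u

open PocSet

open PocSet

theorem PocSet.eventually_mem_iff_of_tendsto_tychonoff {H : Type u} {ι : Type*} {l : Filter ι}
    {αs : ι → Set H} {α : Set H}
    (hα : Filter.Tendsto αs l (@nhds (Set H) (tychonoff H) α)) (h : H) :
    ∀ᶠ n in l, (h ∈ αs n ↔ h ∈ α) := by
  classical
  rw [tychonoff, nhds_induced, Filter.tendsto_comap_iff, tendsto_pi_nhds] at hα
  have hh := hα h
  rw [nhds_discrete, Filter.tendsto_pure] at hh
  filter_upwards [hh] with n hn
  simpa using hn

theorem stmt16 {H : Type u} [PartialOrder H] (P : PocSet H)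
    (σs τs : ℕ → Set H) (σ τ : Set H)
    (hσs : ∀ n, P.IsUltra (σs n)) (hτs : ∀ n, P.IsUltra (τs n))
    (hσ : P.IsUltra σ) (hτ : P.IsUltra τ)
    (M : ℕ) (hM : ∀ n, (σs n \ τs n).encard ≤ (M : ℕ∞)) :
    (letI : TopologicalSpace (Set H) := tychonoff H
     Filter.Tendsto σs Filter.atTop (nhds σ) →
     Filter.Tendsto τs Filter.atTop (nhds τ) →
     (σ \ τ).Finite) := by
  intro hσ_lim hτ_lim
  by_contra hinf
  obtain ⟨t, ht, hcard⟩ := Set.Infinite.exists_subset_card_eq hinf (M + 1)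
  have hsub : ∀ᶠ n in Filter.atTop, ∀ h ∈ t, h ∈ σs n \ τs n := by
    rw [Filter.eventually_all_finset]
    intro h hh
    filter_upwards [eventually_mem_iff_of_tendsto_tychonoff hσ_lim h,
      eventually_mem_iff_of_tendsto_tychonoff hτ_lim h] with n h₁ h₂
    exact ⟨h₁.2 (ht hh).1, fun hn => (ht hh).2 (h₂.1 hn)⟩
  obtain ⟨n, hn⟩ := hsub.exists
  have hle := (Set.encard_le_encard (s := (t : Set H)) hn).trans (hM n)
  rw [Set.encard_coe_eq_coe_finsetCard, hcard, Nat.cast_le] at hle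
  omega
end

section
/- Let H be a poc-set and let (π_n)_{n≥1} be a sequence of ultrafilters on H that is a geodesic ray with respect to Δ, meaning Δ(π_n, π_m) = |n − m| for all n, m ≥ 1. Then (π_n) converges in the Tychonoff topology to the ultrafilter σ = {h ∈ H | h ∈ π_n for all but finitely many n} (in particular this set is an ultrafilter). Moreover the averaged sequence defined by π'_1 = π_1 and π'_{n+1} = med(π'_n, π_{n+1}, σ) coincides with (π_n): π'_n = π_n for all n. -/
universe u

open PocSet

open PocSet

namespace PocSet

variable {H : Type u}

theorem mem_diff_of_encard_add_le {α β γ : Set H} (hfin : (α \ γ).encard ≠ ⊤)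
    (hadd : (α \ β).encard + (β \ γ).encard ≤ (α \ γ).encard) {h : H}
    (hh : h ∈ (α \ β) ∪ (β \ γ)) : h ∈ α \ γ := by
  have hsub : α \ γ ⊆ (α \ β) ∪ (β \ γ) := by
    intro x hx
    by_cases hb : x ∈ β
    · exact Or.inr ⟨hb, hx.2⟩
    · exact Or.inl ⟨hx.1, hb⟩
  have hle := (Set.encard_union_le (α \ β) (β \ γ)).trans hadd
  rwa [(Set.encard_ne_top_iff.1 hfin).eq_of_subset_of_encard_le hsub hle]

theorem mem_diff_of_geodesic {πs : ℕ → Set H}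
    (hgeo : ∀ n m, (πs n \ πs m).encard = (Nat.dist n m : ℕ∞)) {i j k : ℕ}
    (hij : i ≤ j) (hjk : j ≤ k) {h : H}
    (hh : h ∈ (πs i \ πs j) ∪ (πs j \ πs k)) : h ∈ πs i \ πs k := by
  refine mem_diff_of_encard_add_le ?_ ?_ hh
  · rw [hgeo]
    exact ENat.natCast_ne_top _
  · rw [hgeo, hgeo, hgeo, Nat.dist_eq_sub_of_le hij, Nat.dist_eq_sub_of_le hjk,
      Nat.dist_eq_sub_of_le (hij.trans hjk)]
    exact_mod_cast (by omega : j - i + (k - j) ≤ k - i)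

theorem eventually_mem_or_eventually_notMem_of_geodesic {πs : ℕ → Set H}
    (hgeo : ∀ n m, (πs n \ πs m).encard = (Nat.dist n m : ℕ∞)) (h : H) :
    (∃ N, ∀ n ≥ N, h ∈ πs n) ∨ ∃ N, ∀ n ≥ N, h ∉ πs n := by
  by_contra! hcon
  obtain ⟨hout, hin⟩ := hcon
  obtain ⟨i, -, hi⟩ := hin 0
  obtain ⟨j, hij, hj⟩ := hout i
  obtain ⟨k, hjk, hk⟩ := hin j
  exact (mem_diff_of_geodesic hgeo hij hjk (Or.inl ⟨hi, hj⟩)).2 hk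

theorem isUltra_liminf_of_geodesic [PartialOrder H] {P : PocSet H} {πs : ℕ → Set H}
    (hu : ∀ n, P.IsUltra (πs n))
    (hgeo : ∀ n m, (πs n \ πs m).encard = (Nat.dist n m : ℕ∞)) :
    P.IsUltra {h : H | ∃ N, ∀ n ≥ N, h ∈ πs n} := by
  refine ⟨fun h => ⟨?_, fun hs => ?_⟩, ?_⟩
  · rintro ⟨N, hN⟩ ⟨M, hM⟩
    exact ((hu (max N M)).1 h).1 (hN _ (le_max_left _ _)) (hM _ (le_max_right _ _))
  · rcases eventually_mem_or_eventually_notMem_of_geodesic hgeo (P.star h) with hin | ⟨N, hN⟩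
    · exact absurd hin hs
    · exact ⟨N, fun n hn => ((hu n).1 h).2 (hN n hn)⟩
  · rintro h ⟨N, hN⟩ k ⟨M, hM⟩
    exact (hu (max N M)).2 h (hN _ (le_max_left _ _)) k (hM _ (le_max_right _ _))

theorem tendsto_tychonoff {ι : Type*} {l : Filter ι} {f : ι → Set H} {α : Set H}
    (hf : ∀ h, ∀ᶠ i in l, (h ∈ f i ↔ h ∈ α)) :
    Filter.Tendsto f l (@nhds _ (tychonoff H) α) := by
  rw [tychonoff, nhds_induced, Filter.tendsto_comap_iff, tendsto_pi_nhds]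
  intro h
  refine tendsto_const_nhds.congr' ?_
  filter_upwards [hf h] with i hi
  simp [hi]

theorem med_succ_of_geodesic {πs : ℕ → Set H}
    (hgeo : ∀ n m, (πs n \ πs m).encard = (Nat.dist n m : ℕ∞)) (n : ℕ) :
    med (πs n) (πs (n + 1)) {h : H | ∃ N, ∀ n ≥ N, h ∈ πs n} = πs (n + 1) := by
  ext h
  constructor
  · rintro ((⟨-, hh⟩ | ⟨hh, -⟩) | ⟨hn, N, hN⟩)
    · exact hh
    · exact hh
    · by_contra hout
      exact (mem_diff_of_geodesic hgeo n.le_succ (le_max_left (n + 1) N)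
        (Or.inl ⟨hn, hout⟩)).2 (hN _ (le_max_right _ _))
  · intro hh
    by_cases hn : h ∈ πs n
    · exact Or.inl (Or.inl ⟨hn, hh⟩)
    · refine Or.inl (Or.inr ⟨hh, n + 1, fun m hm => ?_⟩)
      by_contra hout
      exact hn (mem_diff_of_geodesic hgeo n.le_succ hm (Or.inr ⟨hh, hout⟩)).1

end PocSet

theorem stmt18 {H : Type u} [PartialOrder H] (P : PocSet H)
    (πs : ℕ → Set H) (hu : ∀ n, P.IsUltra (πs n))
    (hgeo : ∀ n m, (πs n \ πs m).encard = (Nat.dist n m : ℕ∞)) :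
    (letI : TopologicalSpace (Set H) := tychonoff H
     P.IsUltra {h : H | ∃ N, ∀ n ≥ N, h ∈ πs n} ∧
     Filter.Tendsto πs Filter.atTop (nhds {h : H | ∃ N, ∀ n ≥ N, h ∈ πs n}) ∧
     ∀ π' : ℕ → Set H, π' 0 = πs 0 →
       (∀ n, π' (n + 1) = med (π' n) (πs (n + 1)) {h : H | ∃ N, ∀ n ≥ N, h ∈ πs n}) →
       ∀ n, π' n = πs n) := by
  refine ⟨isUltra_liminf_of_geodesic hu hgeo, tendsto_tychonoff fun h => ?_, ?_⟩
  · rcases eventually_mem_or_eventually_notMem_of_geodesic hgeo h with ⟨N, hN⟩ | ⟨N, hN⟩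
    · filter_upwards [Filter.eventually_ge_atTop N] with n hn
      exact iff_of_true (hN n hn) ⟨N, hN⟩
    · filter_upwards [Filter.eventually_ge_atTop N] with n hn
      refine iff_of_false (hN n hn) ?_
      rintro ⟨M, hM⟩
      exact hN _ (le_max_left N M) (hM _ (le_max_right N M))
  · intro π' h0 hsucc n
    induction n with
    | zero => exact h0
    | succ n ih => rw [hsucc, ih, med_succ_of_geodesic hgeo]
end
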